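/- Abductive forgetting may violate overreaching monotony: for F = (a∧b→m) ∧ (¬b∨¬c) ∧ (a∧c→m'), hypotheses I = {a,b,c}, manifestations C = {m,m'}, and remembered variables R = {a,c,m,m'}, the set summarize(⟨F,I,C⟩,R) contains a ⇒ {m} and {a,c} ⇒ {m'} but does not contain {a,c} ⇒ {m}, hence it violates overreaching monotony. -/

import Mathlib

variable {V : Type*}

/-- A truth assignment `v` satisfies all variables of a finite set `E`. -/
def satAll (v : V → Prop) (E : Finset V) : Prop := ∀ x ∈ E, v x

/-- A propositional formula is identified with its set of models.
`F` supports the explanation `E ⇒ M` if `F ∪ E` is consistent and entails `M`. -/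
def supports (F : (V → Prop) → Prop) (E M : Finset V) : Prop :=
  (∃ v, F v ∧ satAll v E) ∧ ∀ v, F v → satAll v E → satAll v M

/-- The set of explanations over hypotheses `I` and manifestations `C`
supported by the formula `F`. -/
def abduct (F : (V → Prop) → Prop) (I C : Finset V) :
    Set (Finset V × Finset V) :=
  {p | p.1 ⊆ I ∧ p.2 ⊆ C ∧ p.2 ≠ ∅ ∧ supports F p.1 p.2}

/-- Focusing the abduction frame `⟨F, I, C⟩` on the variables `R`. -/
def focus [DecidableEq V] (F : (V → Prop) → Prop) (I C R : Finset V) :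
    Set (Finset V × Finset V) :=
  {p | p.1 ⊆ I ∩ R ∧ p.2 ⊆ C ∩ R ∧ p.2 ≠ ∅ ∧
    ∃ E' ⊆ I \ R, ∃ M' ⊆ C \ R, (p.1 ∪ E', p.2 ∪ M') ∈ abduct F I C}

/-- Summarizing the abduction frame `⟨F, I, C⟩` on the variables `R`. -/
def summarize [DecidableEq V] (F : (V → Prop) → Prop) (I C R : Finset V) :
    Set (Finset V × Finset V) :=
  {p | p.1 ⊆ I ∩ R ∧ p.2 ⊆ C ∩ R ∧
    ∃ E' ⊆ I \ R, (p.1 ∪ E', p.2) ∈ abduct F I C}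

/-- Overreaching monotony. -/
def overMonot (S : Set (Finset V × Finset V)) : Prop :=
  ∀ E E' E'' : Finset V, ∀ m m' : V,
    E ⊆ E' → E' ⊆ E'' →
    (E, ({m} : Finset V)) ∈ S → (E'', ({m'} : Finset V)) ∈ S →
    (E', ({m} : Finset V)) ∈ S

/-- Abductive forgetting may violate overreaching monotony. With variables
`a = 0`, `b = 1`, `c = 2`, `m = 3`, `m' = 4`, the formula
`F = (a∧b→m) ∧ (¬b∨¬c) ∧ (a∧c→m')`, hypotheses `I = {a,b,c}`, manifestations
`C = {m,m'}` and remembered variables `R = {a,c,m,m'}`: summarizing contains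
`{a} ⇒ {m}` and `{a,c} ⇒ {m'}` but not `{a,c} ⇒ {m}`, hence it violates
overreaching monotony. -/
theorem forgetting_violates_overMonot :
    (({0}, {3}) : Finset (Fin 5) × Finset (Fin 5)) ∈
      summarize (fun v : Fin 5 → Prop =>
          ((v 0 ∧ v 1) → v 3) ∧ (¬ v 1 ∨ ¬ v 2) ∧ ((v 0 ∧ v 2) → v 4))
        ({0, 1, 2} : Finset (Fin 5)) ({3, 4} : Finset (Fin 5))
        ({0, 2, 3, 4} : Finset (Fin 5)) ∧
    (({0, 2}, {4}) : Finset (Fin 5) × Finset (Fin 5)) ∈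
      summarize (fun v : Fin 5 → Prop =>
          ((v 0 ∧ v 1) → v 3) ∧ (¬ v 1 ∨ ¬ v 2) ∧ ((v 0 ∧ v 2) → v 4))
        ({0, 1, 2} : Finset (Fin 5)) ({3, 4} : Finset (Fin 5))
        ({0, 2, 3, 4} : Finset (Fin 5)) ∧
    (({0, 2}, {3}) : Finset (Fin 5) × Finset (Fin 5)) ∉
      summarize (fun v : Fin 5 → Prop =>
          ((v 0 ∧ v 1) → v 3) ∧ (¬ v 1 ∨ ¬ v 2) ∧ ((v 0 ∧ v 2) → v 4))
        ({0, 1, 2} : Finset (Fin 5)) ({3, 4} : Finset (Fin 5))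
        ({0, 2, 3, 4} : Finset (Fin 5)) ∧
    ¬ overMonot
      (summarize (fun v : Fin 5 → Prop =>
          ((v 0 ∧ v 1) → v 3) ∧ (¬ v 1 ∨ ¬ v 2) ∧ ((v 0 ∧ v 2) → v 4))
        ({0, 1, 2} : Finset (Fin 5)) ({3, 4} : Finset (Fin 5))
        ({0, 2, 3, 4} : Finset (Fin 5))) := by
  refine (fun h1 h2 h3 => ⟨h1, h2, h3, fun h =>
    h3 (h {0} {0, 2} {0, 2} 3 4 (by decide) (by decide) h1 h2)⟩) ?_ ?_ ?_
  · refine ⟨by decide, by decide, {1}, by decide, by decide, by decide, by decide, ?_, ?_⟩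
    · refine ⟨fun x => x ≠ 2, by simp, ?_⟩
      intro x hx
      revert x
      decide
    · intro v hF hE x hx
      have h0 : v 0 := hE 0 (by decide)
      have h1 : v 1 := hE 1 (by decide)
      have hx3 : x = 3 := by simpa using hx
      rw [hx3]
      exact hF.1 ⟨h0, h1⟩
  · refine ⟨by decide, by decide, ∅, by decide, by decide, by decide, by decide, ?_, ?_⟩
    · refine ⟨fun x => x ≠ 1, by simp, ?_⟩
      intro x hx
      revert x
      decide
    · intro v hF hE x hx
      have h0 : v 0 := hE 0 (by decide)
      have h2 : v 2 := hE 2 (by decide)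
      have hx4 : x = 4 := by simpa using hx
      rw [hx4]
      exact hF.2.2 ⟨h0, h2⟩
  · rintro ⟨-, -, E', hE', -, -, -, ⟨v, hF, hv⟩, hent⟩
    have hsub : ∀ x ∈ E', x = 1 := by
      intro x hx
      have key : ∀ y ∈ (({0, 1, 2} : Finset (Fin 5)) \ {0, 2, 3, 4}), y = 1 := by decide
      exact key x (hE' hx)
    have h2 : v 2 := hv 2 (by simp)
    have hn1 : (1 : Fin 5) ∉ E' := by
      intro h
      have h1 : v 1 := hv 1 (by simp [h])
      rcases hF.2.1 with h' | h'
      · exact h' h1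
      · exact h' h2
    have := hent (fun x => x = 0 ∨ x = 2 ∨ x = 4) (by simp) (by
      intro x hx
      simp only [Finset.mem_union, Finset.mem_insert, Finset.mem_singleton] at hx
      rcases hx with (h | h) | h
      · exact Or.inl h
      · exact Or.inr (Or.inl h)
      · exact absurd (hsub x h ▸ h) hn1) 3 (by simp)
    revert this
    decide
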